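/- Let N, M be integers with 0 ≤ M < N, set α = M/N, and let λ > 0. Let (G₁ᵢ)_{i=1}^N and (G₂ᵢ)_{i=1}^N be 2N independent random variables, each distributed according to the gamma distribution with shape 1/(N−M) and scale λ. Let Y = ∑_{i=1}^N (G₁ᵢ − G₂ᵢ). Then the standard deviation of |Y| satisfies √(E|Y|² − (E|Y|)²) = √(2/(1−α) − 4/B(1/2, 1/(1−α))²) · λ, where B(x, y) = Γ(x)Γ(y)/Γ(x+y) is the beta function. -/

import Mathlib

open MeasureTheory ProbabilityTheory Real

open scoped ENNReal

lemma measurable_gammaPDF (a r : ℝ) : Measurable (gammaPDF a r) :=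
  (measurable_gammaPDFReal a r).ennreal_ofReal

lemma integral_gammaMeasure {a r : ℝ} (ha : 0 < a) (hr : 0 < r) (f : ℝ → ℝ) :
    ∫ x, f x ∂(gammaMeasure a r) =
      ∫ x in Set.Ioi 0, r ^ a / Gamma a * x ^ (a - 1) * exp (-(r * x)) * f x := by
  rw [gammaMeasure, integral_withDensity_eq_integral_toReal_smul
    (measurable_gammaPDF a r) (by simp [gammaPDF]),
    ← integral_Ici_eq_integral_Ioi, ← integral_indicator measurableSet_Ici]
  refine integral_congr_ae (.of_forall fun x ↦ ?_)
  by_cases hx : 0 ≤ x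
  · have h := gammaPDFReal_nonneg ha hr x
    simp only [gammaPDF, ENNReal.toReal_ofReal h]
    simp [gammaPDFReal, hx]
  · simp [gammaPDF, gammaPDFReal, hx]

lemma lintegral_gammaMeasure {a r : ℝ} {f : ℝ → ℝ≥0∞} (hf : Measurable f) :
    ∫⁻ x, f x ∂(gammaMeasure a r) =
      ∫⁻ x in Set.Ioi 0, ENNReal.ofReal (r ^ a / Gamma a * x ^ (a - 1) * exp (-(r * x))) * f x := by
  rw [gammaMeasure, lintegral_withDensity_eq_lintegral_mul _
    (measurable_gammaPDF a r) hf,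
    setLIntegral_congr Ioi_ae_eq_Ici, ← lintegral_indicator measurableSet_Ici]
  refine lintegral_congr fun x ↦ ?_
  by_cases hx : 0 ≤ x <;> simp [gammaPDF, gammaPDFReal, hx]

/-- The moments of the gamma distribution. -/
lemma integral_pow_gammaMeasure {a r : ℝ} (ha : 0 < a) (hr : 0 < r) (n : ℕ) :
    ∫ x, x ^ n ∂(gammaMeasure a r) = Gamma (a + n) / (Gamma a * r ^ n) := by
  have han : 0 < a + n := by positivity
  have hΓ := (Gamma_pos_of_pos ha).ne'
  rw [integral_gammaMeasure ha hr]
  calc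
    _ = ∫ x in Set.Ioi (0 : ℝ), r ^ a / Gamma a * (x ^ (a + n - 1) * exp (-(r * x))) := by
      refine setIntegral_congr_fun measurableSet_Ioi fun x (hx : 0 < x) ↦ ?_
      rw [show a + n - 1 = (a - 1) + n by ring, rpow_add hx, rpow_natCast]
      ring
    _ = _ := by
      rw [integral_const_mul, integral_rpow_mul_exp_neg_mul_Ioi han hr, one_div,
        inv_rpow hr.le, rpow_add hr, rpow_natCast]
      field_simp

lemma integrable_pow_gammaMeasure {a r : ℝ} (ha : 0 < a) (hr : 0 < r) (n : ℕ) :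
    Integrable (fun x ↦ x ^ n) (gammaMeasure a r) := by
  refine .of_integral_ne_zero ?_
  rw [integral_pow_gammaMeasure ha hr]
  have := Gamma_pos_of_pos ha
  have := Gamma_pos_of_pos (show 0 < a + n by positivity)
  positivity

lemma mgf_gammaMeasure_of_lt {a r t : ℝ} (ha : 0 < a) (hr : 0 < r) (ht : t < r) :
    mgf id (gammaMeasure a r) t = (r / (r - t)) ^ a := by
  have hrt : 0 < r - t := sub_pos.2 ht
  have hΓ := (Gamma_pos_of_pos ha).ne'
  rw [mgf, integral_gammaMeasure ha hr]
  calc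
    _ = ∫ x in Set.Ioi (0 : ℝ), r ^ a / Gamma a * (x ^ (a - 1) * exp (-((r - t) * x))) := by
      refine setIntegral_congr_fun measurableSet_Ioi fun x (hx : 0 < x) ↦ ?_
      simp only [id]
      rw [show -((r - t) * x) = -(r * x) + t * x by ring, exp_add]
      ring
    _ = _ := by
      rw [integral_const_mul, integral_rpow_mul_exp_neg_mul_Ioi ha hrt, one_div,
        inv_rpow hrt.le, div_rpow hr.le hrt.le]
      field_simp

lemma mgf_gammaMeasure_of_le {a r t : ℝ} (ha : 0 < a) (hr : 0 < r) (ht : r ≤ t) :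
    mgf id (gammaMeasure a r) t = 0 := by
  have hΓ := Gamma_pos_of_pos ha
  rw [mgf, integral_gammaMeasure ha hr]
  refine integral_undef fun h ↦ not_integrableOn_Ioi_rpow (a - 1) ?_
  refine (h.const_mul (Gamma a / r ^ a)).mono' (by fun_prop) ?_
  refine (ae_restrict_iff' measurableSet_Ioi).2 (.of_forall fun x (hx : 0 < x) ↦ ?_)
  have hra := rpow_pos_of_pos hr a
  have hxa := rpow_pos_of_pos hx (a - 1)
  have h1 : 1 ≤ exp (-(r * x)) * exp (t * x) := by
    rw [← exp_add]
    exact one_le_exp (by nlinarith)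
  rw [norm_of_nonneg hxa.le]
  calc
    x ^ (a - 1) ≤ x ^ (a - 1) * (exp (-(r * x)) * exp (t * x)) := le_mul_of_one_le_right hxa.le h1
    _ = _ := by
      simp only [id]
      field_simp

lemma zero_mem_interior_integrableExpSet_gammaMeasure {a r : ℝ} (ha : 0 < a) (hr : 0 < r) :
    0 ∈ interior (integrableExpSet id (gammaMeasure a r)) := by
  have := isProbabilityMeasure_gammaMeasure ha hr
  refine mem_interior.2 ⟨Set.Iio r, fun t (ht : t < r) ↦ ?_, isOpen_Iio, hr⟩
  refine mgf_pos_iff.1 ?_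
  rw [mgf_gammaMeasure_of_lt ha hr ht]
  have : 0 < r - t := sub_pos.2 ht
  positivity

/-- Probability measures on `ℝ` with the same moment-generating function, finite near `0`, agree. -/
lemma MeasureTheory.Measure.ext_of_mgf_id_eq {μ ν : Measure ℝ} [IsProbabilityMeasure μ]
    [IsProbabilityMeasure ν] (h : mgf id μ = mgf id ν)
    (h0 : 0 ∈ interior (integrableExpSet id μ)) : μ = ν := by
  refine Measure.ext_of_charFun (funext fun t ↦ ?_)
  rw [← complexMGF_id_mul_I, ← complexMGF_id_mul_I]
  exact eqOn_complexMGF_of_mgf h (by simpa using h0)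

/-- A sum of i.i.d. gamma variables is gamma distributed, with the shapes added. -/
lemma map_sum_pi_gammaMeasure {ι : Type*} [Fintype ι] [Nonempty ι] {a r : ℝ} (ha : 0 < a)
    (hr : 0 < r) :
    (Measure.pi fun _ : ι ↦ gammaMeasure a r).map (fun p ↦ ∑ i, p i) =
      gammaMeasure (Fintype.card ι * a) r := by
  have hn : (0 : ℝ) < Fintype.card ι * a := mul_pos (by exact_mod_cast Fintype.card_pos) ha
  have := isProbabilityMeasure_gammaMeasure ha hr
  have := isProbabilityMeasure_gammaMeasure hn hr
  have hm : Measurable fun p : ι → ℝ ↦ ∑ i, p i := by fun_prop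
  have := Measure.isProbabilityMeasure_map (μ := Measure.pi fun _ : ι ↦ gammaMeasure a r)
    hm.aemeasurable
  refine (Measure.ext_of_mgf_id_eq (funext fun t ↦ ?_)
    (zero_mem_interior_integrableExpSet_gammaMeasure hn hr)).symm
  have hprod : mgf id ((Measure.pi fun _ : ι ↦ gammaMeasure a r).map (fun p ↦ ∑ i, p i)) t =
      mgf id (gammaMeasure a r) t ^ Fintype.card ι := by
    rw [mgf_id_map hm.aemeasurable]
    simp only [mgf, Finset.mul_sum, exp_sum, id]
    exact integral_fintype_prod_eq_pow (μ := gammaMeasure a r) fun x : ℝ ↦ exp (t * x)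
  rw [hprod]
  rcases lt_or_ge t r with ht | ht
  · rw [mgf_gammaMeasure_of_lt ha hr ht, mgf_gammaMeasure_of_lt hn hr ht, mul_comm,
      rpow_mul (div_pos hr (sub_pos.2 ht)).le, rpow_natCast]
  · rw [mgf_gammaMeasure_of_le ha hr ht, mgf_gammaMeasure_of_le hn hr ht,
      zero_pow Fintype.card_ne_zero]

lemma integral_sq_sub_gammaMeasure {a r : ℝ} (ha : 0 < a) (hr : 0 < r) :
    ∫ q : ℝ × ℝ, (q.1 - q.2) ^ 2 ∂((gammaMeasure a r).prod (gammaMeasure a r)) =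
      2 * a / r ^ 2 := by
  have := isProbabilityMeasure_gammaMeasure ha hr
  have h1 := integrable_pow_gammaMeasure ha hr 1
  have h2 := integrable_pow_gammaMeasure ha hr 2
  simp only [pow_one] at h1
  have e1 := integral_pow_gammaMeasure ha hr 1
  have e2 := integral_pow_gammaMeasure ha hr 2
  have hΓ := (Gamma_pos_of_pos ha).ne'
  have g1 := Gamma_add_one ha.ne'
  have g2 := Gamma_add_one (show a + 1 ≠ 0 by positivity)
  rw [add_assoc, one_add_one_eq_two] at g2
  simp only [pow_one, Nat.cast_one, g1, Nat.cast_ofNat, g2] at e1 e2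
  calc
    _ = ∫ q : ℝ × ℝ, (q.1 ^ 2 + q.2 ^ 2 - 2 * (q.1 * q.2))
          ∂((gammaMeasure a r).prod (gammaMeasure a r)) := by
      congr with q
      ring
    _ = _ := by
      have hadd := (h2.comp_fst (gammaMeasure a r)).add (h2.comp_snd (gammaMeasure a r))
      have hmul := (h1.mul_prod h1).const_mul 2
      rw [integral_sub (by exact hadd) (by exact hmul), integral_add (h2.comp_fst _)
        (h2.comp_snd _), integral_const_mul, integral_prod_mul (fun x : ℝ ↦ x) (fun x : ℝ ↦ x),
        integral_fun_fst (fun x : ℝ ↦ x ^ 2), integral_fun_snd (fun x : ℝ ↦ x ^ 2), e1, e2]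
      simp
      field_simp
      ring

lemma lintegral_Ioi_eq_mul_lintegral_comp_mul_left (f : ℝ → ℝ≥0∞) {x : ℝ} (hx : 0 < x) :
    ∫⁻ y in Set.Ioi 0, f y = ENNReal.ofReal x * ∫⁻ v in Set.Ioi 0, f (x * v) := by
  have himg : (fun v ↦ x * v) '' Set.Ioi 0 = Set.Ioi 0 := by
    simp [Set.image_mul_left_Ioi hx]
  rw [← lintegral_const_mul' _ _ ENNReal.ofReal_ne_top]
  conv_lhs => rw [← himg]
  rw [lintegral_image_eq_lintegral_abs_deriv_mul measurableSet_Ioi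
    (fun v _ ↦ by simpa using ((hasDerivAt_id v).const_mul x).hasDerivWithinAt)
    (mul_right_injective₀ hx.ne').injOn]
  simp [abs_of_pos hx]

lemma setLIntegral_Ioo_one_sub_mul_rpow {a : ℝ} (ha : 0 < a) :
    ∫⁻ v in Set.Ioo (0 : ℝ) 1,
        ENNReal.ofReal ((1 - v) * v ^ (a - 1) * (1 + v) ^ (-(2 * a + 1))) =
      ENNReal.ofReal (2 ^ (-(2 * a)) / a) := by
  have hcont : ContinuousOn (fun v : ℝ ↦ v ^ a * (1 + v) ^ (-(2 * a)) / a) (Set.Icc 0 1) := by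
    refine ((continuousOn_id.rpow_const fun _ _ ↦ .inr ha.le).mul
      (ContinuousOn.rpow_const (by fun_prop) fun v hv ↦ .inl ?_)).div_const _
    have := hv.1
    positivity
  have hderiv : ∀ v ∈ Set.Ioo (0 : ℝ) 1,
      HasDerivAt (fun v : ℝ ↦ v ^ a * (1 + v) ^ (-(2 * a)) / a)
        ((1 - v) * v ^ (a - 1) * (1 + v) ^ (-(2 * a + 1))) v := by
    intro v hv
    have hv0 : 0 < v := hv.1
    have hv1 : 0 < 1 + v := by positivity
    have h1 := hasDerivAt_rpow_const (x := v) (p := a) (.inl hv0.ne')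
    have h2 : HasDerivAt (fun v : ℝ ↦ (1 + v) ^ (-(2 * a)))
        (-(2 * a) * (1 + v) ^ (-(2 * a) - 1)) v := by
      simpa using ((hasDerivAt_id v).const_add 1).rpow_const (p := -(2 * a)) (.inl hv1.ne')
    refine ((h1.mul h2).div_const a).congr_deriv ?_
    have e1 : v ^ a = v * v ^ (a - 1) := by
      rw [rpow_sub_one hv0.ne']
      field_simp
    have e2 : (1 + v) ^ (-(2 * a)) = (1 + v) * (1 + v) ^ (-(2 * a + 1)) := by
      rw [show -(2 * a + 1) = -(2 * a) - 1 by ring, rpow_sub_one hv1.ne']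
      field_simp
    rw [e1, e2, show -(2 * a) - 1 = -(2 * a + 1) by ring]
    field_simp
    ring
  have hpos : ∀ v ∈ Set.Ioo (0 : ℝ) 1,
      0 ≤ (1 - v) * v ^ (a - 1) * (1 + v) ^ (-(2 * a + 1)) := by
    intro v hv
    have hv0 : 0 < v := hv.1
    have hv1 : 0 ≤ 1 - v := sub_nonneg.2 hv.2.le
    positivity
  have hint := intervalIntegral.integrableOn_deriv_of_nonneg hcont hderiv hpos
  rw [← ofReal_integral_eq_lintegral_ofReal (hint.mono_set Set.Ioo_subset_Ioc_self)
    ((ae_restrict_iff' measurableSet_Ioo).2 (.of_forall hpos)), ← integral_Ioc_eq_integral_Ioo,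
    ← intervalIntegral.integral_of_le zero_le_one,
    intervalIntegral.integral_eq_sub_of_hasDerivAt_of_le zero_le_one hcont hderiv
      ((intervalIntegrable_iff_integrableOn_Ioc_of_le zero_le_one).2 hint)]
  simp [zero_rpow ha.ne', one_add_one_eq_two]

lemma lintegral_ofReal_sub_gammaMeasure {a r : ℝ} (ha : 0 < a) (hr : 0 < r) :
    ∫⁻ x, ∫⁻ y, ENNReal.ofReal (x - y) ∂(gammaMeasure a r) ∂(gammaMeasure a r) =
      ENNReal.ofReal (Gamma (2 * a + 1) / (Gamma a ^ 2 * r) * (2 ^ (-(2 * a)) / a)) := by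
  have := isProbabilityMeasure_gammaMeasure ha hr
  have hΓ := Gamma_pos_of_pos ha
  have hΓ2 := Gamma_pos_of_pos (show 0 < 2 * a + 1 by positivity)
  set c := r ^ a / Gamma a with hc
  have hcpos : 0 < c := by positivity
  rw [lintegral_gammaMeasure (by fun_prop)]
  calc
    _ = ∫⁻ x in Set.Ioi (0 : ℝ), ∫⁻ v in Set.Ioi (0 : ℝ),
        ENNReal.ofReal (c * x ^ (a - 1) * exp (-(r * x))) * (ENNReal.ofReal x *
        (ENNReal.ofReal (c * (x * v) ^ (a - 1) * exp (-(r * (x * v)))) *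
          ENNReal.ofReal (x - x * v))) := by
      refine setLIntegral_congr_fun measurableSet_Ioi fun x (hx : 0 < x) ↦ ?_
      rw [lintegral_gammaMeasure (by fun_prop), lintegral_Ioi_eq_mul_lintegral_comp_mul_left _ hx,
        lintegral_const_mul' _ _ ENNReal.ofReal_ne_top,
        lintegral_const_mul' _ _ ENNReal.ofReal_ne_top]
    _ = ∫⁻ v in Set.Ioi (0 : ℝ), ∫⁻ x in Set.Ioi (0 : ℝ),
        ENNReal.ofReal (c * x ^ (a - 1) * exp (-(r * x))) * (ENNReal.ofReal x *
        (ENNReal.ofReal (c * (x * v) ^ (a - 1) * exp (-(r * (x * v)))) *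
          ENNReal.ofReal (x - x * v))) := lintegral_lintegral_swap (by fun_prop)
    _ = ∫⁻ v in Set.Ioi (0 : ℝ), (Set.Ioo (0 : ℝ) 1).indicator (fun v ↦
        ENNReal.ofReal (Gamma (2 * a + 1) / (Gamma a ^ 2 * r)) *
        ENNReal.ofReal ((1 - v) * v ^ (a - 1) * (1 + v) ^ (-(2 * a + 1)))) v := by
      refine setLIntegral_congr_fun measurableSet_Ioi fun v (hv : 0 < v) ↦ ?_
      rcases lt_or_ge v 1 with hv1 | hv1
      · have hs : 0 < 1 - v := sub_pos.2 hv1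
        have hk : 0 < 2 * a + 1 := by positivity
        have hrv : 0 < r * (1 + v) := by positivity
        have hI := integral_rpow_mul_exp_neg_mul_Ioi hk hrv
        have hIpos : 0 < (1 / (r * (1 + v))) ^ (2 * a + 1) * Gamma (2 * a + 1) := by positivity
        have hint := (Integrable.of_integral_ne_zero (hI ▸ hIpos.ne')).const_mul
          (c ^ 2 * ((1 - v) * v ^ (a - 1)))
        rw [Set.indicator_of_mem (show v ∈ Set.Ioo (0 : ℝ) 1 from ⟨hv, hv1⟩),
          ← ENNReal.ofReal_mul (by positivity)]
        calc
          _ = ∫⁻ x in Set.Ioi (0 : ℝ), ENNReal.ofReal (c ^ 2 * ((1 - v) * v ^ (a - 1)) *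
              (x ^ (2 * a + 1 - 1) * exp (-(r * (1 + v) * x)))) := by
            refine setLIntegral_congr_fun measurableSet_Ioi fun x (hx : 0 < x) ↦ ?_
            rw [← ENNReal.ofReal_mul (by positivity), ← ENNReal.ofReal_mul (by positivity),
              ← ENNReal.ofReal_mul (by positivity)]
            congr 1
            rw [mul_rpow hx.le hv.le, show 2 * a + 1 - 1 = (a - 1) + (a - 1) + 1 + 1 by ring,
              rpow_add_one hx.ne', rpow_add_one hx.ne', rpow_add hx,
              show -(r * (1 + v) * x) = -(r * x) + -(r * (x * v)) by ring, exp_add]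
            ring
          _ = _ := by
            rw [← ofReal_integral_eq_lintegral_ofReal hint
              ((ae_restrict_iff' measurableSet_Ioi).2 (.of_forall fun x (hx : 0 < x) ↦ by
                simp only [Pi.zero_apply]; positivity)), integral_const_mul, hI]
            congr 1
            rw [one_div, inv_rpow hrv.le, mul_rpow hr.le (by positivity), rpow_neg (by positivity),
              rpow_add_one hr.ne', two_mul a, rpow_add hr, hc]
            field_simp
      · rw [Set.indicator_of_notMem (fun h ↦ hv1.not_gt h.2), setLIntegral_congr_fun
          (g := fun _ ↦ 0) measurableSet_Ioi fun x (hx : 0 < x) ↦ ?_, lintegral_zero]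
        have : x - x * v ≤ 0 := by nlinarith
        simp [ENNReal.ofReal_of_nonpos this]
    _ = _ := by
      rw [lintegral_indicator measurableSet_Ioo, Measure.restrict_restrict measurableSet_Ioo,
        Set.inter_eq_left.2 Set.Ioo_subset_Ioi_self, lintegral_const_mul' _ _ ENNReal.ofReal_ne_top,
        setLIntegral_Ioo_one_sub_mul_rpow ha, ← ENNReal.ofReal_mul (by positivity)]

/-- The mean absolute difference of two i.i.d. gamma variables. -/
lemma integral_abs_sub_gammaMeasure {a r : ℝ} (ha : 0 < a) (hr : 0 < r) :
    ∫ q : ℝ × ℝ, |q.1 - q.2| ∂((gammaMeasure a r).prod (gammaMeasure a r)) =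
      2 / (Gamma (1 / 2) * Gamma a / Gamma (1 / 2 + a)) / r := by
  have := isProbabilityMeasure_gammaMeasure ha hr
  have hΓ := Gamma_pos_of_pos ha
  have hΓ2 := Gamma_pos_of_pos (show 0 < 2 * a + 1 by positivity)
  have habs (x y : ℝ) :
      ENNReal.ofReal |x - y| = ENNReal.ofReal (x - y) + ENNReal.ofReal (y - x) := by
    rcases le_total y x with h | h
    · rw [abs_of_nonneg (sub_nonneg.2 h), ENNReal.ofReal_of_nonpos (sub_nonpos.2 h), add_zero]
    · rw [abs_of_nonpos (sub_nonpos.2 h), ENNReal.ofReal_of_nonpos (sub_nonpos.2 h), zero_add,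
        neg_sub]
  have hsum : ∫⁻ q : ℝ × ℝ, ENNReal.ofReal |q.1 - q.2|
      ∂((gammaMeasure a r).prod (gammaMeasure a r)) =
      ENNReal.ofReal (2 * (Gamma (2 * a + 1) / (Gamma a ^ 2 * r) * (2 ^ (-(2 * a)) / a))) := by
    simp only [habs]
    rw [lintegral_add_left (by fun_prop), lintegral_prod _ (by fun_prop),
      lintegral_prod_symm _ (by fun_prop), lintegral_ofReal_sub_gammaMeasure ha hr,
      ← ENNReal.ofReal_add (by positivity) (by positivity), two_mul (_ * _)]
  rw [integral_eq_lintegral_of_nonneg_ae (.of_forall fun _ ↦ abs_nonneg _)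
    (by fun_prop), hsum, ENNReal.toReal_ofReal (by positivity), Gamma_one_half_eq,
    Gamma_add_one (by positivity)]
  have hdup := Gamma_mul_Gamma_add_half a
  rw [sub_eq_add_neg, rpow_add two_pos, rpow_one, add_comm a] at hdup
  have h2a : Gamma (2 * a) * 2 ^ (-(2 * a)) = Gamma a * Gamma (1 / 2 + a) / (2 * √π) := by
    rw [hdup]
    field_simp
  calc
    _ = 4 * (Gamma (2 * a) * 2 ^ (-(2 * a))) / (Gamma a ^ 2 * r) := by
      field_simp
      ring
    _ = _ := by
      rw [h2a]
      have := Gamma_pos_of_pos (show 0 < 1 / 2 + a by positivity)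
      field_simp
      ring

lemma integral_pi_prod_pi_gammaMeasure {ι : Type*} [Fintype ι] [Nonempty ι] {a r : ℝ}
    (ha : 0 < a) (hr : 0 < r) {f : ℝ → ℝ} (hf : Measurable f) :
    ∫ p : (ι → ℝ) × (ι → ℝ), f (∑ i, (p.1 i - p.2 i))
        ∂((Measure.pi fun _ : ι ↦ gammaMeasure a r).prod
          (Measure.pi fun _ : ι ↦ gammaMeasure a r)) =
      ∫ q : ℝ × ℝ, f (q.1 - q.2) ∂((gammaMeasure (Fintype.card ι * a) r).prod
        (gammaMeasure (Fintype.card ι * a) r)) := by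
  have := isProbabilityMeasure_gammaMeasure ha hr
  have hm : Measurable fun p : ι → ℝ ↦ ∑ i, p i := by fun_prop
  have hfm : Measurable fun q : ℝ × ℝ ↦ f (q.1 - q.2) := by fun_prop
  rw [← map_sum_pi_gammaMeasure ha hr, Measure.map_prod_map _ _ hm hm,
    integral_map (hm.prodMap hm).aemeasurable
      hfm.aestronglyMeasurable]
  simp [Finset.sum_sub_distrib]

/-- Utility theorem (standard deviation part): for the total noise
`Y = ∑_{i=1}^N (G₁ᵢ - G₂ᵢ)`, with all `2N` variables i.i.d. gamma of shape `1/(N-M)`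
and scale `λ` (rate `1/λ`), the standard deviation of `|Y|` equals
`√(2/(1-α) - 4/B(1/2, 1/(1-α))²) · λ` with `α = M/N`. -/
theorem utility_stddev (N M : ℕ) (hM : M < N) (lam : ℝ) (hlam : 0 < lam) :
    Real.sqrt
      ((∫ p : (Fin N → ℝ) × (Fin N → ℝ), |∑ i, (p.1 i - p.2 i)| ^ 2
          ∂((Measure.pi fun _ : Fin N => gammaMeasure (1 / ((N : ℝ) - M)) (1 / lam)).prod
              (Measure.pi fun _ : Fin N => gammaMeasure (1 / ((N : ℝ) - M)) (1 / lam))))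
        - (∫ p : (Fin N → ℝ) × (Fin N → ℝ), |∑ i, (p.1 i - p.2 i)|
            ∂((Measure.pi fun _ : Fin N => gammaMeasure (1 / ((N : ℝ) - M)) (1 / lam)).prod
                (Measure.pi fun _ : Fin N => gammaMeasure (1 / ((N : ℝ) - M)) (1 / lam)))) ^ 2)
      = Real.sqrt (2 / (1 - (M : ℝ) / N) -
            4 / (Real.Gamma (1 / 2) * Real.Gamma (1 / (1 - (M : ℝ) / N)) /
                  Real.Gamma (1 / 2 + 1 / (1 - (M : ℝ) / N))) ^ 2) * lam := by
  have hMN : (0 : ℝ) < N - M := sub_pos.2 (by exact_mod_cast hM)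
  have hN : (0 : ℝ) < N := by exact_mod_cast (Nat.zero_le M).trans_lt hM
  have : Nonempty (Fin N) := ⟨⟨M, hM⟩⟩
  have ha : 0 < 1 / ((N : ℝ) - M) := by positivity
  have hr : 0 < 1 / lam := by positivity
  have hk : (Fintype.card (Fin N) : ℝ) * (1 / (N - M)) = 1 / (1 - (M : ℝ) / N) := by
    rw [Fintype.card_fin]
    field_simp
  have hk0 : 0 < 1 / (1 - (M : ℝ) / N) := by
    rw [← hk, Fintype.card_fin]
    positivity
  simp only [sq_abs]
  rw [integral_pi_prod_pi_gammaMeasure ha hr (f := fun y ↦ y ^ 2) (by fun_prop),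
    integral_pi_prod_pi_gammaMeasure ha hr (f := fun y ↦ |y|) (by fun_prop), hk,
    integral_sq_sub_gammaMeasure hk0 hr, integral_abs_sub_gammaMeasure hk0 hr]
  conv_rhs => rw [← sqrt_sq hlam.le]
  rw [← sqrt_mul' _ (sq_nonneg lam)]
  congr 1
  simp only [div_pow, div_div_eq_mul_div]
  ring
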